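/- There exist at least 8 pairwise distinct magic knight's tours of the 6×12 board, i.e. at least 8 distinct bijective numberings each of which is a knight's tour with all six 12-cell rows summing to 438 and all twelve 6-cell columns summing to 219. -/

import Mathlib

/-- Two cells are a knight's move apart: coordinate differences in absolute
value are {1,2}. -/
def knightMove {m n : ℕ} (a b : Fin m × Fin n) : Prop :=
  (((a.1.val : ℤ) - b.1.val).natAbs = 1 ∧ ((a.2.val : ℤ) - b.2.val).natAbs = 2) ∨
  (((a.1.val : ℤ) - b.1.val).natAbs = 2 ∧ ((a.2.val : ℤ) - b.2.val).natAbs = 1)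

/-- A knight's tour of the m×n board: a bijective numbering (as an equiv from
`Fin (m*n)`, representing the numbers 1,…,m·n) of the cells, such that
consecutive numbers occupy cells a knight's move apart. -/
def IsKnightTour (m n : ℕ) (t : Fin (m * n) ≃ Fin m × Fin n) : Prop :=
  ∀ (k : ℕ) (h : k + 1 < m * n),
    knightMove (t ⟨k, Nat.lt_of_succ_lt h⟩) (t ⟨k + 1, h⟩)

/-- The number (in 1,…,m·n) assigned to a cell by the tour. -/
def cellNum {m n : ℕ} (t : Fin (m * n) ≃ Fin m × Fin n) (c : Fin m × Fin n) : ℕ :=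
  (t.symm c).val + 1

/-- The sum of the numbers in row `i` (an n-cell line). -/
def rowSum {m n : ℕ} (t : Fin (m * n) ≃ Fin m × Fin n) (i : Fin m) : ℕ :=
  ∑ j : Fin n, cellNum t (i, j)

/-- The sum of the numbers in column `j` (an m-cell line). -/
def colSum {m n : ℕ} (t : Fin (m * n) ≃ Fin m × Fin n) (j : Fin n) : ℕ :=
  ∑ i : Fin m, cellNum t (i, j)

/-- A permutation of the 72 squares: the `k`-th entry is the index `12 * row + column` of the cell
visited at step `k` of a magic knight's tour of the 6×12 board. -/
def magicTourPerm : Equiv.Perm (Fin (6 * 12)) where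
  toFun := ![
    71, 46, 56, 33, 23, 9, 19, 5, 30, 55, 65, 40, 63, 49, 26, 3, 13, 36,
    50, 60, 37, 12, 2, 27, 4, 18, 41, 64, 54, 31, 8, 22, 32, 57, 47, 70,
    45, 20, 10, 35, 58, 68, 43, 66, 52, 29, 6, 16, 39, 62, 48, 25, 0, 14,
    24, 1, 15, 38, 61, 51, 28, 53, 67, 42, 17, 7, 21, 11, 34, 59, 69, 44]
  invFun := ![
    52, 55, 22, 15, 24, 7, 46, 65, 30, 5, 38, 67, 21, 16, 53, 56, 47, 64,
    25, 6, 37, 66, 31, 4, 54, 51, 14, 23, 60, 45, 8, 29, 32, 3, 68, 39,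
    17, 20, 57, 48, 11, 26, 63, 42, 71, 36, 1, 34, 50, 13, 18, 59, 44, 61,
    28, 9, 2, 33, 40, 69, 19, 58, 49, 12, 27, 10, 43, 62, 41, 70, 35, 0]
  left_inv := by unfold Function.LeftInverse; decide +kernel
  right_inv := by unfold Function.RightInverse Function.LeftInverse; decide +kernel

/-- A magic knight's tour of the 6×12 board. -/
def magicTour : Fin (6 * 12) ≃ Fin 6 × Fin 12 :=
  magicTourPerm.trans finProdFinEquiv.symm

/-- The images of `magicTour` under reversal of the numbering and the symmetries of the board,
indexed by the binary digits of `a`. -/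
def magicTourImage (a : Fin 8) : Fin (6 * 12) ≃ Fin 6 × Fin 12 :=
  (if a.val.testBit 0 then Fin.revPerm else Equiv.refl _).trans <|
    magicTour.trans <|
      Equiv.prodCongr (if a.val.testBit 1 then Fin.revPerm else Equiv.refl _)
        (if a.val.testBit 2 then Fin.revPerm else Equiv.refl _)

instance {m n : ℕ} (a b : Fin m × Fin n) : Decidable (knightMove a b) :=
  inferInstanceAs (Decidable (_ ∨ _))

/-- The tour condition, phrased over a finite type of steps so that it can be decided. -/
theorem isKnightTour_of_forall_fin {m n : ℕ} {t : Fin (m * n) ≃ Fin m × Fin n}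
    (h : ∀ k : Fin (m * n), ∀ hk : k.val + 1 < m * n, knightMove (t k) (t ⟨k.val + 1, hk⟩)) :
    IsKnightTour m n t :=
  fun k hk => h ⟨k, Nat.lt_of_succ_lt hk⟩ hk

theorem isKnightTour_magicTourImage (a : Fin 8) : IsKnightTour 6 12 (magicTourImage a) := by
  refine isKnightTour_of_forall_fin ?_
  revert a
  decide +kernel

theorem rowSum_magicTourImage : ∀ (a : Fin 8) (i : Fin 6), rowSum (magicTourImage a) i = 438 := by
  decide +kernel

theorem colSum_magicTourImage : ∀ (a : Fin 8) (j : Fin 12), colSum (magicTourImage a) j = 219 := by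
  decide +kernel

theorem magicTourImage_injective : Function.Injective magicTourImage := by
  have key : ∀ a b : Fin 8, magicTourImage a 0 = magicTourImage b 0 → a = b := by
    decide +kernel
  exact fun a b hab => key a b (congrArg (· 0) hab)

/-- There exist at least 8 pairwise distinct magic knight's tours of the
6×12 board. -/
theorem eight_magic_tours_6x12 :
    ∃ f : Fin 8 → (Fin (6 * 12) ≃ Fin 6 × Fin 12), Function.Injective f ∧
      ∀ a : Fin 8, IsKnightTour 6 12 (f a) ∧
        (∀ i : Fin 6, rowSum (f a) i = 438) ∧
        (∀ j : Fin 12, colSum (f a) j = 219) :=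
  ⟨magicTourImage, magicTourImage_injective, fun a =>
    ⟨isKnightTour_magicTourImage a, rowSum_magicTourImage a, colSum_magicTourImage a⟩⟩
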